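/- arXiv:2503.21320 — 2 statements merged into one kernel-verified Lean document; each statement's English description precedes it below -/
import Mathlib

section
/- For all 0 < p < 1, C_{J_sym}(p) < 0.5893 + 0.9724 · p/(1−p) + 0.1405 · p²/(1−p²)². -/
open Real
open scoped Classical

/-- `h_J(s,p) = ((1-p)^s/p²) Σ_{k ∈ ℤ⁺ \ J} (k²/(k+s)²) C(k+s,k) p^k`. -/
noncomputable def hJfun (J : Set ℕ) (s : ℕ) (p : ℝ) : ℝ :=
  ((1-p)^s / p^2) * ∑' k : ℕ,
    if 1 ≤ k ∧ k ∉ J then ((k:ℝ)^2 / ((k:ℝ) + s)^2) * (Nat.choose (k+s) k : ℝ) * p^k else 0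

/-- `C_J(p) = sup_{s ∈ ℤ⁺} h_J(s,p)`. -/
noncomputable def CJ (J : Set ℕ) (p : ℝ) : ℝ := ⨆ s : ℕ+, hJfun J s p

/-- `J_sym = {2} ∪ {odd positive integers}`. -/
def Jsym : Set ℕ := {2} ∪ {k | Odd k}

theorem cubic_taylor_le_exp (t : ℝ) : 1 + t + t ^ 2 / 2 + t ^ 3 / 6 ≤ exp t := by
  rcases le_total 0 t with ht | ht
  · have h := Real.sum_le_exp_of_nonneg ht 4
    simp only [Finset.sum_range_succ, Finset.sum_range_zero, Nat.factorial] at h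
    norm_num at h
    linarith
  · have hd (y : ℝ) : HasDerivAt (fun y => exp y - (1 + y + y ^ 2 / 2 + y ^ 3 / 6))
        (exp y - (1 + y + y ^ 2 / 2)) y := by
      have h := (Real.hasDerivAt_exp y).sub
        ((((hasDerivAt_id y).const_add 1).add (((hasDerivAt_id y).pow 2).div_const 2)).add
          (((hasDerivAt_id y).pow 3).div_const 6))
      refine h.congr_deriv ?_
      simp
      ring
    have hd' (y : ℝ) : HasDerivAt (fun y => exp y - (1 + y + y ^ 2 / 2)) (exp y - (1 + y)) y := by
      have h := (Real.hasDerivAt_exp y).sub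
        (((hasDerivAt_id y).const_add 1).add (((hasDerivAt_id y).pow 2).div_const 2))
      refine h.congr_deriv ?_
      simp
    have hmono : Monotone (fun y : ℝ => exp y - (1 + y + y ^ 2 / 2)) :=
      monotone_of_hasDerivAt_nonneg hd' fun y => by
        have := Real.add_one_le_exp y
        simp only [Pi.zero_apply]
        linarith
    have hanti : AntitoneOn (fun y : ℝ => exp y - (1 + y + y ^ 2 / 2 + y ^ 3 / 6))
        (Set.Iic 0) := by
      refine antitoneOn_of_deriv_nonpos (convex_Iic 0)
        (fun y _ => (hd y).continuousAt.continuousWithinAt)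
        (fun y _ => (hd y).differentiableAt.differentiableWithinAt) fun y hy => ?_
      rw [(hd y).deriv]
      have hy0 : y ≤ 0 := by simpa using interior_subset hy
      have := hmono hy0
      simpa using this
    have := hanti (Set.mem_Iic.2 ht) (Set.mem_Iic.2 le_rfl) ht
    simp at this
    linarith

theorem cubic_taylor_le_mul_exp_neg {c K : ℝ} (hK : exp c ≤ K) (x : ℝ) :
    1 + (c - x) + (c - x) ^ 2 / 2 + (c - x) ^ 3 / 6 ≤ K * exp (-x) :=
  calc _ ≤ exp (c - x) := cubic_taylor_le_exp _
    _ = exp c * exp (-x) := by rw [← Real.exp_add]; congr 1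
    _ ≤ K * exp (-x) := by gcongr

theorem sub_one_mul_exp_neg_le {c K : ℝ} (hc : 2 ≤ c) (hK : K ≤ exp c) {x : ℝ} (hx : c ≤ x) :
    K * ((x - 1) * exp (-x)) ≤ c - 1 := by
  have h := Real.add_one_le_exp (x - c)
  have hx1 : x - 1 ≤ (c - 1) * exp (x - c) := by nlinarith
  have he : exp c * (exp (x - c) * exp (-x)) = 1 := by
    rw [← Real.exp_add, ← Real.exp_add, Real.exp_eq_one_iff]; ring
  have h1 : 0 ≤ (x - 1) * exp (-x) := mul_nonneg (by linarith) (Real.exp_pos _).le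
  calc K * ((x - 1) * exp (-x)) ≤ exp c * ((x - 1) * exp (-x)) := by gcongr
    _ ≤ exp c * ((c - 1) * exp (x - c) * exp (-x)) := by gcongr
    _ = (c - 1) * (exp c * (exp (x - c) * exp (-x))) := by ring
    _ = c - 1 := by rw [he, mul_one]

theorem exp_nat_div_ten_le {n : ℕ} {K : ℝ} (hK : 0 ≤ K)
    (h : (2.7182818286 : ℝ) ^ n ≤ K ^ 10) : exp (n / 10) ≤ K := by
  refine le_of_pow_le_pow_left₀ (n := 10) (by norm_num) hK (le_trans ?_ h)
  rw [← Real.exp_nat_mul, show ((10 : ℕ) : ℝ) * (n / 10) = n * 1 by push_cast; ring,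
    Real.exp_nat_mul]
  gcongr
  exact Real.exp_one_lt_d9.le

theorem le_exp_nat_div_ten {n : ℕ} {K : ℝ}
    (h : K ^ 10 ≤ (2.7182818283 : ℝ) ^ n) : K ≤ exp (n / 10) := by
  refine le_of_pow_le_pow_left₀ (n := 10) (by norm_num) (Real.exp_pos _).le (h.trans ?_)
  rw [← Real.exp_nat_mul, show ((10 : ℕ) : ℝ) * (n / 10) = n * 1 by push_cast; ring,
    Real.exp_nat_mul]
  gcongr
  exact Real.exp_one_gt_d9.le

/-- The small-`p` limit of the bound for `h_J(s, p)`, with `x = s p / (1 - p)` held fixed. -/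
theorem limit_profile_le {x : ℝ} (hx0 : 0 ≤ x) (hx6 : x ≤ 6) :
    1 / 2 + 1 / 2 * (x - 1) * exp (-x) ^ 2 - 2 * x * exp (-x) ≤ 0.0893 * x := by
  have hm := Real.exp_pos (-x)
  rcases le_total x 1 with hx1 | hx1
  · have hL := cubic_taylor_le_exp (-x)
    set m := exp (-x)
    have hL0 : 0 ≤ 1 - x + x ^ 2 / 2 - x ^ 3 / 6 := by nlinarith [pow_nonneg hx0 3, sq_nonneg x]
    have hLm : 1 - x + x ^ 2 / 2 - x ^ 3 / 6 ≤ m := by linarith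
    have hLs : (1 - x) * (1 - x) ^ 2 ≤ (1 - x) * m ^ 2 := by
      have := Real.add_one_le_exp (-x)
      gcongr
      all_goals linarith
    have hxm : x * (1 - x + x ^ 2 / 2 - x ^ 3 / 6) ≤ x * m := by gcongr
    have h3 : 0 ≤ x * (1 - x) := by nlinarith
    have h4 : 0 ≤ x * (1 - x) ^ 2 := by positivity
    have h5 : x ^ 4 ≤ x ^ 3 := by nlinarith [pow_nonneg hx0 3]
    nlinarith
  rcases le_total x 3.8 with hx2 | hx2
  · have hL := cubic_taylor_le_mul_exp_neg
      (exp_nat_div_ten_le (n := 33) (K := 27.2) (by norm_num) (by norm_num)) x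
    have hK : (x - 1) * exp (-x) ≤ 0.136 := by
      have h1 := Real.add_one_le_exp (x - 2)
      have he : exp (x - 2) * exp (-x) * exp 2 = 1 := by
        rw [← Real.exp_add, ← Real.exp_add, Real.exp_eq_one_iff]; ring
      have h2 := le_exp_nat_div_ten (n := 20) (K := 7.38) (by norm_num)
      norm_num at h2
      have h3 : 0 < exp (x - 2) * exp (-x) := by positivity
      have h4 : (x - 1) * exp (-x) ≤ exp (x - 2) * exp (-x) := by gcongr; linarith
      nlinarith
    set m := exp (-x)
    have hmm : (x - 1) * m ^ 2 ≤ 0.136 * m := by nlinarith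
    obtain ⟨t, rfl⟩ : ∃ t, x = 3.3 - t := ⟨3.3 - x, by ring⟩
    norm_num at hL
    have hb : 0 ≤ (t + 0.5) * (2.3 - t) := mul_nonneg (by linarith) (by linarith)
    have hP : 0 ≤ 27.2 * (0.0893 * (3.3 - t) - 1 / 2)
        + (1 + t + t ^ 2 / 2 + t ^ 3 / 6) * (2 * (3.3 - t) - 0.068) := by
      nlinarith [mul_nonneg (sq_nonneg t) hb, mul_nonneg (show 0 ≤ t + 0.5 by linarith) hb]
    have h2 : 0 ≤ 2 * (3.3 - t) - 0.068 := by linarith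
    nlinarith [mul_le_mul_of_nonneg_right hL h2]
  · have hL := cubic_taylor_le_mul_exp_neg
      (exp_nat_div_ten_le (n := 43) (K := 73.71) (by norm_num) (by norm_num)) x
    have hK := sub_one_mul_exp_neg_le (by norm_num)
      (le_exp_nat_div_ten (n := 38) (K := 44.7) (by norm_num))
      (show ((38 : ℕ) : ℝ) / 10 ≤ x by norm_num at hx2 ⊢; linarith)
    norm_num at hK
    set m := exp (-x)
    have hmm : (x - 1) * m ^ 2 ≤ 0.0627 * m := by nlinarith
    obtain ⟨t, rfl⟩ : ∃ t, x = 4.3 - t := ⟨4.3 - x, by ring⟩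
    norm_num at hL
    have hb : 0 ≤ 1.8 + 0.4281 * t - t ^ 2 / 3 := by nlinarith
    have hP : 0 ≤ 73.71 * (0.0893 * (4.3 - t) - 1 / 2)
        + (1 + t + t ^ 2 / 2 + t ^ 3 / 6) * (2 * (4.3 - t) - 0.03135) := by
      nlinarith [mul_nonneg (sq_nonneg t) hb, sq_nonneg (t - 0.01)]
    have h2 : 0 ≤ 2 * (4.3 - t) - 0.03135 := by linarith
    nlinarith [mul_le_mul_of_nonneg_right hL h2]

theorem exp_neg_div_le_add {y u : ℝ} (hu : 0 ≤ u) : exp (-(y / (1 + u))) ≤ exp (-y) + u := by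
  have h1 : 0 < 1 + u := by linarith
  have h := convexOn_exp.2 (Set.mem_univ (-y)) (Set.mem_univ 0)
    (show 0 ≤ 1 / (1 + u) by positivity) (show 0 ≤ u / (1 + u) by positivity) (by field_simp)
  simp only [smul_eq_mul, mul_zero, add_zero, Real.exp_zero, mul_one] at h
  have hE := Real.exp_pos (-y)
  calc exp (-(y / (1 + u))) = exp (1 / (1 + u) * -y) := by congr 1; ring
    _ ≤ 1 / (1 + u) * exp (-y) + u / (1 + u) := h
    _ ≤ exp (-y) + u := by
      gcongr
      · refine mul_le_of_le_one_left hE.le ((div_le_one h1).2 (by linarith))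
      · exact div_le_self hu (by linarith)

theorem exp_neg_le_div_sq {y : ℝ} (hy : 0 < y) : exp (-(2 * y)) ≤ 0.14 / y ^ 2 := by
  have h1 := Real.add_one_le_exp (y - 1)
  have h2 : y ^ 2 ≤ exp (y - 1) ^ 2 := by gcongr; linarith
  have h3 : exp (y - 1) ^ 2 * exp 2 = exp (2 * y) := by
    rw [← Real.exp_nat_mul, ← Real.exp_add]; congr 1; push_cast; ring
  have h4 := le_exp_nat_div_ten (n := 20) (K := 7.38) (by norm_num)
  norm_num at h4
  rw [le_div_iff₀ (by positivity), Real.exp_neg, inv_mul_le_iff₀ (Real.exp_pos _), ← h3]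
  nlinarith [sq_nonneg (exp (y - 1))]

theorem profile_le {x u w a : ℝ} (hx : 0 < x) (hu : 0 < u) (ha : exp (-x) ≤ a)
    (hw : exp (-x) ^ 2 ≤ w) (hw' : w ≤ exp (-(2 * (x / (1 + u))))) :
    (1 + u) / 2 + (x - 1) / 2 * ((1 + u) / (1 + 2 * u) * w) - 2 * (x + u) * a
      ≤ (0.0893 + 0.4724 * u) * (x + 2 * u) := by
  have hm := Real.exp_pos (-x)
  have hm2 : exp (-(2 * x)) = exp (-x) ^ 2 := by
    rw [← Real.exp_nat_mul]; congr 1; push_cast; ring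
  have hw0 : 0 ≤ w := (sq_nonneg _).trans hw
  have hxu : 2 * (x + u) * exp (-x) ≤ 2 * (x + u) * a := by gcongr
  have hux : 0 < u * x := by positivity
  have hr : (1 + u) / (1 + 2 * u) ≤ 1 := (div_le_one (by linarith)).2 (by linarith)
  rcases le_total x 1 with hx1 | hx1
  · have hp := limit_profile_le hx.le (by linarith)
    have hr' : 1 - u ≤ (1 + u) / (1 + 2 * u) := by
      rw [le_div_iff₀ (by linarith)]; nlinarith
    have hW : (1 - u) * exp (-x) ^ 2 ≤ (1 + u) / (1 + 2 * u) * w :=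
      calc _ ≤ (1 + u) / (1 + 2 * u) * exp (-x) ^ 2 := by gcongr
        _ ≤ _ := by gcongr
    have hm1 : exp (-x) ≤ 1 := Real.exp_le_one_iff.2 (by linarith)
    have hm3 : 1 / 3 ≤ exp (-x) := by
      have h1 := cubic_taylor_le_exp (-x)
      nlinarith [pow_nonneg hx.le 3, sq_nonneg x]
    have hW' : (1 - x) * ((1 - u) * exp (-x) ^ 2) ≤ (1 - x) * ((1 + u) / (1 + 2 * u) * w) := by
      gcongr
    have hs : (1 - x) * exp (-x) ^ 2 ≤ exp (-x) := by nlinarith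
    have hs' := mul_le_mul_of_nonneg_left hs hu.le
    have hs'' := mul_le_mul_of_nonneg_left hm3 hu.le
    nlinarith
  rcases le_total x 6 with hx6 | hx6
  · have hp := limit_profile_le hx.le hx6
    have hW : (1 + u) / (1 + 2 * u) * w ≤ exp (-x) ^ 2 + u :=
      calc _ ≤ w := mul_le_of_le_one_left hw0 hr
        _ ≤ exp (-(2 * x / (1 + u))) := by rwa [mul_div_assoc]
        _ ≤ _ := by rw [← hm2]; exact exp_neg_div_le_add hu.le
    have hW' := mul_le_mul_of_nonneg_left hW (show 0 ≤ x - 1 by linarith)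
    have := mul_le_mul_of_nonneg_left hx6 hu.le
    nlinarith [mul_pos hu hm]
  · have hW : (1 + u) / (1 + 2 * u) * w ≤ 0.14 * (1 + u + u ^ 2) / x ^ 2 :=
      calc _ ≤ (1 + u) / (1 + 2 * u) * (0.14 / (x / (1 + u)) ^ 2) := by
            gcongr; exact hw'.trans (exp_neg_le_div_sq (by positivity))
        _ = 0.14 * ((1 + u) ^ 3 / (1 + 2 * u)) / x ^ 2 := by field_simp
        _ ≤ _ := by
          gcongr
          rw [div_le_iff₀ (by linarith)]
          nlinarith [pow_pos hu 3, pow_pos hu 2]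
    have hW' : (x - 1) * ((1 + u) / (1 + 2 * u) * w) ≤ 0.14 * (1 + u + u ^ 2) / 6 :=
      calc _ ≤ x * (0.14 * (1 + u + u ^ 2) / x ^ 2) := by gcongr; linarith
        _ = 0.14 * (1 + u + u ^ 2) / x := by field_simp
        _ ≤ _ := by gcongr
    have := mul_le_mul_of_nonneg_left hx6 hu.le
    have : 0 ≤ 2 * (x + u) * exp (-x) := by positivity
    nlinarith [sq_nonneg u]

/-- The elementary upper bound for `h_J(s, p)`, in the variable `u = p / (1 - p)`. -/
theorem elementary_bound {s : ℕ} (hs : 1 ≤ s) {u : ℝ} (hu : 0 < u) :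
    (1 + u) / 2 + (1 + u) / (2 * u * (s + 2)) * (1 - ((1 + 2 * u) ^ s)⁻¹)
      + (1 + u) / (2 * (1 + 2 * u)) * ((1 + 2 * u) ^ s)⁻¹
      - 2 * (s + 1) / (s + 2) * ((1 + u) ^ s)⁻¹ ≤ 0.5893 + 0.9724 * u := by
  have hs0 : (0 : ℝ) < s := by exact_mod_cast hs
  have ha : exp (-(s * u)) ≤ ((1 + u) ^ s)⁻¹ := by
    rw [Real.exp_neg, Real.exp_nat_mul]
    gcongr
    linarith [Real.add_one_le_exp u]
  have hw : exp (-(s * u)) ^ 2 ≤ ((1 + 2 * u) ^ s)⁻¹ := by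
    rw [← Real.exp_nat_mul, show ((2 : ℕ) : ℝ) * -(s * u) = -(s * (2 * u)) by push_cast; ring,
      Real.exp_neg, Real.exp_nat_mul]
    gcongr
    linarith [Real.add_one_le_exp (2 * u)]
  have hw' : ((1 + 2 * u) ^ s)⁻¹ ≤ exp (-(2 * (s * u / (1 + u)))) := by
    rw [show 2 * (s * u / (1 + u)) = s * (2 * (u / (1 + u))) by ring, Real.exp_neg,
      Real.exp_nat_mul]
    gcongr
    have h := Real.le_log_one_add_of_nonneg (show 0 ≤ 2 * u by linarith)
    rw [← Real.le_log_iff_exp_le (by linarith)]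
    refine le_of_eq_of_le ?_ h
    field_simp
    ring
  have h := profile_le (mul_pos hs0 hu) hu ha hw hw'
  set w := ((1 + 2 * u) ^ s)⁻¹
  set a := ((1 + u) ^ s)⁻¹
  refine le_of_mul_le_mul_right (a := s * u + 2 * u) ?_ (by positivity)
  have hid : ((1 + u) / 2 + (1 + u) / (2 * u * (s + 2)) * (1 - w)
      + (1 + u) / (2 * (1 + 2 * u)) * w - 2 * (s + 1) / (s + 2) * a) * (s * u + 2 * u)
      = (1 + u) / 2 * (s * u + 2 * u) + ((1 + u) / 2
        + (s * u - 1) / 2 * ((1 + u) / (1 + 2 * u) * w) - 2 * (s * u + u) * a) := by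
    field_simp
    ring
  rw [hid]
  nlinarith

theorem hasSum_even_choose_mul_pow (s : ℕ) {p : ℝ} (hp : |p| < 1) :
    HasSum (fun n : ℕ => ((n + s).choose s : ℝ) * ((p ^ n + (-p) ^ n) / 2))
      ((1 / (1 - p) ^ (s + 1) + 1 / (1 + p) ^ (s + 1)) / 2) := by
  have h1 := hasSum_choose_mul_geometric_of_norm_lt_one s (r := p) hp
  have h2 := hasSum_choose_mul_geometric_of_norm_lt_one s (r := -p) (by simpa using hp)
  rw [sub_neg_eq_add] at h2
  refine ((h1.add h2).div_const 2).congr_fun ?_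
  intro n
  ring

theorem hasSum_odd_choose_mul_pow (r : ℕ) {p : ℝ} (hp : |p| < 1) :
    HasSum (fun n : ℕ => ((n + 1 + r).choose r : ℝ) * ((p ^ (n + 1) - (-p) ^ (n + 1)) / 2))
      ((1 / (1 - p) ^ (r + 1) - 1 / (1 + p) ^ (r + 1)) / 2) := by
  have h1 := hasSum_choose_mul_geometric_of_norm_lt_one r (r := p) hp
  have h2 := hasSum_choose_mul_geometric_of_norm_lt_one r (r := -p) (by simpa using hp)
  rw [sub_neg_eq_add] at h2
  have h := (h1.sub h2).div_const 2
  rw [← hasSum_nat_add_iff' 1] at h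
  simp only [Finset.sum_range_one, pow_zero, sub_self, zero_div, sub_zero] at h
  refine h.congr_fun ?_
  intro n
  ring

/-- Partial fractions for the coefficients of `h_J(r + 1, p)`, with the last denominator
`n + r + 3` replaced by `r + 3`. -/
theorem coeff_le (n r : ℕ) :
    ((n + 2 : ℕ) : ℝ) ^ 2 / (((n + 2 : ℕ) : ℝ) + (r + 1 : ℕ)) ^ 2
        * ((n + 2 + (r + 1)).choose (n + 2) : ℝ)
      ≤ ((n + (r + 1)).choose (r + 1) : ℝ) + ((n + 1 + r).choose r : ℝ) / (r + 3) := by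
  have e1 : ((n + 1 + r).choose r : ℝ) * (n + 1) = ((n + (r + 1)).choose (r + 1) : ℝ) * (r + 1) := by
    have h := Nat.choose_succ_right_eq (n + (r + 1)) r
    rw [show n + (r + 1) - r = n + 1 by omega] at h
    rw [show n + 1 + r = n + (r + 1) by ring]
    exact_mod_cast h.symm
  have e2 : ((n + 2 + (r + 1)).choose (n + 2) : ℝ) * ((n + 1) * (n + 2))
      = ((n + (r + 1)).choose (r + 1) : ℝ) * ((n + r + 2) * (n + r + 3)) := by
    have h1 := Nat.choose_mul_succ_eq (n + (r + 1)) (r + 1)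
    have h2 := Nat.choose_mul_succ_eq (n + (r + 1) + 1) (r + 1)
    rw [show n + (r + 1) + 1 - (r + 1) = n + 1 by omega] at h1
    rw [show n + (r + 1) + 1 + 1 - (r + 1) = n + 2 by omega] at h2
    rw [Nat.choose_symm_add, show n + 2 + (r + 1) = n + (r + 1) + 1 + 1 by ring]
    have h1' : ((n + (r + 1)).choose (r + 1) : ℝ) * (n + (r + 1) + 1)
      = ((n + (r + 1) + 1).choose (r + 1) : ℝ) * (n + 1) := by exact_mod_cast h1
    have h2' : ((n + (r + 1) + 1).choose (r + 1) : ℝ) * (n + (r + 1) + 1 + 1)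
      = ((n + (r + 1) + 1 + 1).choose (r + 1) : ℝ) * (n + 2) := by exact_mod_cast h2
    linear_combination (-(n + 1 : ℝ)) * h2' - (n + r + 3 : ℝ) * h1'
  have hY : (0 : ℝ) ≤ ((n + (r + 1)).choose (r + 1) : ℝ) := Nat.cast_nonneg _
  rw [← eq_div_iff (by positivity)] at e1 e2
  rw [e1, e2]
  set Y : ℝ := ((n + (r + 1)).choose (r + 1) : ℝ)
  push_cast
  calc _ = Y + Y * (r + 1) / (n + 1) / (n + r + 3) := by field_simp; ring
    _ ≤ _ := by
      gcongr
      linarith [show (0 : ℝ) ≤ n from Nat.cast_nonneg n]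

theorem hJfun_Jsym_le (r : ℕ) {p : ℝ} (hp : 0 < p) (hp1 : p < 1) :
    hJfun Jsym (r + 1) p ≤ (1 - p) ^ (r + 1)
      * ((1 / (1 - p) ^ (r + 2) + 1 / (1 + p) ^ (r + 2)) / 2
        + (1 / (1 - p) ^ (r + 1) - 1 / (1 + p) ^ (r + 1)) / 2 / (p * (r + 3))
        - 2 * (r + 2) / (r + 3)) := by
  have hpa : |p| < 1 := by rwa [abs_of_pos hp]
  have hq : 0 < 1 - p := by linarith
  set t : ℕ → ℝ := fun k => if 1 ≤ k ∧ k ∉ Jsym then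
    ((k : ℝ) ^ 2 / ((k : ℝ) + (r + 1 : ℕ)) ^ 2) * (Nat.choose (k + (r + 1)) k : ℝ) * p ^ k else 0
    with ht
  have ht0 (k : ℕ) : 0 ≤ t k := by
    simp only [ht]
    split_ifs
    · positivity
    · exact le_rfl
  have hV := (((hasSum_even_choose_mul_pow (r + 1) hpa).add
    ((hasSum_odd_choose_mul_pow r hpa).div_const (p * (r + 3)))).sub
      (hasSum_ite_eq (0 : ℕ) (2 * (r + 2) / (r + 3) : ℝ))).mul_left (p ^ 2)
  have hle (n : ℕ) : t (n + 2) ≤ p ^ 2 * (((n + (r + 1)).choose (r + 1) : ℝ)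
      * ((p ^ n + (-p) ^ n) / 2) + ((n + 1 + r).choose r : ℝ)
      * ((p ^ (n + 1) - (-p) ^ (n + 1)) / 2) / (p * (r + 3))
      - if n = 0 then (2 * (r + 2) / (r + 3) : ℝ) else 0) := by
    rcases Nat.even_or_odd n with hn | hn
    · have hc := coeff_le n r
      rw [pow_succ (-p), hn.neg_pow, show p ^ (n + 1) - p ^ n * -p = 2 * (p ^ n * p) by ring]
      by_cases hn0 : n = 0
      · subst hn0
        have : t (0 + 2) = 0 := by simp [ht, Jsym]
        rw [this]
        simp only [if_true]
        have h1 : (0 + 1 + r).choose r = r + 1 := by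
          rw [show 0 + 1 + r = r + 1 by ring, Nat.choose_succ_self_right]
        rw [h1]
        simp only [zero_add, Nat.choose_self]
        push_cast
        apply le_of_eq
        field_simp
        ring
      · rw [if_neg hn0, sub_zero]
        have hmem : n + 2 ∉ Jsym := by
          simp only [Jsym, Set.mem_union, Set.mem_singleton_iff, Set.mem_ofPred_eq, not_or,
            Nat.not_odd_iff_even]
          exact ⟨by omega, hn.add even_two⟩
        simp only [ht]
        rw [if_pos ⟨by omega, hmem⟩]
        calc _ ≤ (((n + (r + 1)).choose (r + 1) : ℝ) + ((n + 1 + r).choose r : ℝ) / (r + 3))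
              * p ^ (n + 2) := by gcongr
          _ = _ := by field_simp; ring
    · have hmem : n + 2 ∈ Jsym := Or.inr (hn.add_even even_two)
      have hn0 : n ≠ 0 := by rintro rfl; simp at hn
      have : t (n + 2) = 0 := by simp [ht, hmem]
      rw [this, if_neg hn0, pow_succ (-p), hn.neg_pow]
      apply le_of_eq
      ring
  have hs : Summable fun n => t (n + 2) := Summable.of_nonneg_of_le (fun n => ht0 _) hle hV.summable
  have ht2 : ∑' k, t k = ∑' n, t (n + 2) := by
    have h := ((summable_nat_add_iff 2).1 hs).sum_add_tsum_nat_add 2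
    have h01 : ∑ i ∈ Finset.range 2, t i = 0 := by simp [Finset.sum_range_succ, ht, Jsym]
    rw [← h, h01, zero_add]
  have hfin := ht2.trans_le ((hs.tsum_le_tsum hle hV.summable).trans_eq hV.tsum_eq)
  have h : (1 - p) ^ (r + 1) / p ^ 2 * ∑' k, t k ≤ (1 - p) ^ (r + 1) / p ^ 2 * _ :=
    mul_le_mul_of_nonneg_left hfin (by positivity)
  rwa [← mul_assoc, div_mul_cancel₀ _ (by positivity)] at h

theorem hJfun_Jsym_le_linear {s : ℕ} (hs : 1 ≤ s) {p : ℝ} (hp : 0 < p) (hp1 : p < 1) :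
    hJfun Jsym s p ≤ 0.5893 + 0.9724 * p / (1 - p) := by
  obtain ⟨r, rfl⟩ : ∃ r, s = r + 1 := ⟨s - 1, by omega⟩
  have hq : 0 < 1 - p := by linarith
  have h := elementary_bound hs (div_pos hp hq)
  have h1 : 1 + p / (1 - p) = (1 - p)⁻¹ := by field_simp; ring
  have h2 : 1 + 2 * (p / (1 - p)) = (1 + p) / (1 - p) := by field_simp; ring
  rw [h1, h2] at h
  refine ((hJfun_Jsym_le r hp hp1).trans_eq ?_).trans (h.trans_eq (by rw [mul_div_assoc]))
  push_cast
  have : (1 + p) ≠ 0 := by linarith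
  rw [inv_pow, inv_inv, div_pow, inv_div, pow_succ _ (r + 1), pow_succ _ (r + 1)]
  field_simp
  ring

theorem stmt5 (p : ℝ) (hp : 0 < p) (hp1 : p < 1) :
    CJ Jsym p < 0.5893 + 0.9724 * p / (1 - p) + 0.1405 * p^2 / (1 - p^2)^2 := by
  have hq : 0 < 1 - p ^ 2 := by nlinarith
  have hpos : 0 < 0.1405 * p ^ 2 / (1 - p ^ 2) ^ 2 := by positivity
  have hle : CJ Jsym p ≤ 0.5893 + 0.9724 * p / (1 - p) :=
    ciSup_le fun s => hJfun_Jsym_le_linear s.pos hp hp1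
  linarith
end

section
/- Let Y be a real random variable with a Lebesgue density and finite χ²-distance to the standard normal, and let J be a set of positive integers such that 𝔼H_n(Y) = 0 for all n ∈ J. If χ²(Y,𝒩) < inf_{x>0} (e^{x/2} − 1)² / (e^x − 1 − Σ_{n∈J} x^n/n!), then 𝔼 e^{tY} < e^{t²} for all real t ≠ 0. -/
open MeasureTheory ProbabilityTheory Real
open scoped Classical

/-- Density of the standard normal distribution. -/
noncomputable def stdGaussianDensity (x : ℝ) : ℝ := Real.exp (-x^2/2) / Real.sqrt (2*Real.pi)

/-- χ² distance between (the law of) a random variable `X` (with Lebesgue density given by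
`MeasureTheory.pdf`) and the standard normal distribution. -/
noncomputable def chiSqDist {Ω : Type*} [MeasureSpace Ω] (X : Ω → ℝ) : ℝ :=
  ∫ x, ((MeasureTheory.pdf X ℙ volume x).toReal / stdGaussianDensity x - 1)^2
    * stdGaussianDensity x

/-- The χ² distance of `X` to the standard normal is finite (the defining integral converges). -/
def HasFiniteChiSq {Ω : Type*} [MeasureSpace Ω] (X : Ω → ℝ) : Prop :=
  MeasureTheory.Integrable (fun x =>
    ((MeasureTheory.pdf X ℙ volume x).toReal / stdGaussianDensity x - 1)^2
      * stdGaussianDensity x)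

/-- The `m`-th probabilists' Hermite polynomial, evaluated at `x : ℝ`. -/
noncomputable def Hermite (m : ℕ) (x : ℝ) : ℝ := Polynomial.aeval x (Polynomial.hermite m)

theorem hasDerivAt_Hermite (n : ℕ) (x : ℝ) :
    HasDerivAt (Hermite n) (x * Hermite n x - Hermite (n + 1) x) x := by
  exact ((Polynomial.hermite n).hasDerivAt_aeval x).congr_deriv
    (by simp [Hermite, Polynomial.hermite_succ])

theorem stdGaussianDensity_eq_gaussianPDFReal (x : ℝ) :
    stdGaussianDensity x = gaussianPDFReal 0 1 x := by
  simp [stdGaussianDensity, gaussianPDFReal, div_eq_inv_mul]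

theorem stdGaussianDensity_pos (x : ℝ) : 0 < stdGaussianDensity x := by
  unfold stdGaussianDensity
  positivity

theorem measurable_stdGaussianDensity : Measurable stdGaussianDensity := by
  unfold stdGaussianDensity
  fun_prop

theorem hasDerivAt_stdGaussianDensity (x : ℝ) :
    HasDerivAt stdGaussianDensity (-x * stdGaussianDensity x) x := by
  have h : HasDerivAt (fun y : ℝ => -y ^ 2 / 2) (-x) x := by
    exact ((hasDerivAt_pow 2 x).neg.div_const 2).congr_deriv (by ring)
  exact (h.exp.div_const √(2 * π)).congr_deriv (by simp only [stdGaussianDensity]; ring)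

theorem integral_gaussianReal_eq (f : ℝ → ℝ) :
    ∫ x, f x ∂gaussianReal 0 1 = ∫ x, f x * stdGaussianDensity x := by
  rw [integral_gaussianReal_eq_integral_smul one_ne_zero]
  simp [stdGaussianDensity_eq_gaussianPDFReal, mul_comm]

theorem integrable_gaussianReal_iff (f : ℝ → ℝ) :
    Integrable f (gaussianReal 0 1) ↔ Integrable fun x => f x * stdGaussianDensity x := by
  rw [gaussianReal_of_var_ne_zero _ one_ne_zero,
    integrable_withDensity_iff_integrable_smul' (measurable_gaussianPDF _ _)
      (by simp [gaussianPDF_lt_top])]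
  simp [stdGaussianDensity_eq_gaussianPDFReal, mul_comm]

/-- Polynomials times exponentials are integrable for the standard Gaussian. -/
theorem integrable_aeval_mul_exp {R : Type*} [CommSemiring R] [Algebra R ℝ] (P : Polynomial R)
    (t : ℝ) :
    Integrable (fun x : ℝ => Polynomial.aeval x P * exp (t * x)) (gaussianReal 0 1) := by
  simp only [Polynomial.aeval_eq_sum_range, Finset.sum_mul]
  refine integrable_finsetSum _ fun i _ => ?_
  simp only [Algebra.smul_def, mul_assoc]
  refine Integrable.const_mul ?_ _
  exact integrable_pow_mul_exp_of_mem_interior_integrableExpSet (X := fun x : ℝ => x)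
    (by simp [integrableExpSet_fun_id_gaussianReal]) i

theorem integrable_aeval {R : Type*} [CommSemiring R] [Algebra R ℝ] (P : Polynomial R) :
    Integrable (fun x : ℝ => Polynomial.aeval x P) (gaussianReal 0 1) := by
  simpa using integrable_aeval_mul_exp P 0

theorem memLp_Hermite (n : ℕ) : MemLp (Hermite n) 2 (gaussianReal 0 1) := by
  have hc : Continuous (Hermite n) := Polynomial.continuous_aeval _
  rw [memLp_two_iff_integrable_sq hc.aestronglyMeasurable]
  exact (integrable_aeval (Polynomial.hermite n ^ 2)).congr
    (.of_forall fun x => map_pow (Polynomial.aeval x) _ _)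

theorem memLp_exp_mul (t : ℝ) : MemLp (fun x => exp (t * x)) 2 (gaussianReal 0 1) := by
  rw [memLp_two_iff_integrable_sq (by fun_prop)]
  simpa [← exp_nat_mul, mul_assoc] using integrable_exp_mul_gaussianReal (μ := 0) (v := 1) (2 * t)

/-- Gaussian integration by parts against Hermite polynomials. -/
theorem integral_Hermite_succ_mul (n : ℕ) {u u' : ℝ → ℝ} (hu : ∀ x, HasDerivAt u (u' x) x)
    (h₀ : Integrable (fun x => Hermite n x * u x) (gaussianReal 0 1))
    (h₁ : Integrable (fun x => Hermite (n + 1) x * u x) (gaussianReal 0 1))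
    (h₂ : Integrable (fun x => Hermite n x * u' x) (gaussianReal 0 1)) :
    ∫ x, Hermite (n + 1) x * u x ∂gaussianReal 0 1
      = ∫ x, Hermite n x * u' x ∂gaussianReal 0 1 := by
  rw [integrable_gaussianReal_iff] at h₀ h₁ h₂
  have hv (x : ℝ) : HasDerivAt (fun y => Hermite n y * stdGaussianDensity y)
      (-(Hermite (n + 1) x * stdGaussianDensity x)) x := by
    exact ((hasDerivAt_Hermite n x).mul (hasDerivAt_stdGaussianDensity x)).congr_deriv (by ring)
  have key := integral_mul_deriv_eq_deriv_mul_of_integrable (fun x _ => hu x) (fun x _ => hv x)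
    (h₁.neg.congr (.of_forall fun x => by simp only [Pi.neg_apply, Pi.mul_apply]; ring))
    (h₂.congr (.of_forall fun x => by simp only [Pi.mul_apply]; ring))
    (h₀.congr (.of_forall fun x => by simp only [Pi.mul_apply]; ring))
  simp only [mul_neg, integral_neg, neg_inj] at key
  simp only [integral_gaussianReal_eq, mul_comm _ (u _), mul_comm _ (u' _), mul_assoc, key]

theorem integral_Hermite_mul_exp (n : ℕ) (t : ℝ) :
    ∫ x, Hermite n x * exp (t * x) ∂gaussianReal 0 1 = t ^ n * exp (t ^ 2 / 2) := by
  induction n with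
  | zero =>
    have := congrFun (mgf_fun_id_gaussianReal (μ := 0) (v := 1)) t
    simpa [Hermite, mgf] using this
  | succ n ih =>
    have hu (x : ℝ) : HasDerivAt (fun y => exp (t * y)) (t * exp (t * x)) x := by
      simpa [mul_comm] using ((hasDerivAt_id x).const_mul t).exp
    have hi (m : ℕ) := integrable_aeval_mul_exp (Polynomial.hermite m) t
    rw [integral_Hermite_succ_mul n hu (hi n) (hi (n + 1))]
    · simp only [mul_left_comm _ t, integral_const_mul, ih]
      ring
    · simpa only [Hermite, mul_left_comm _ t] using (hi n).const_mul t

theorem integral_Hermite_mul_aeval (n : ℕ) (P : Polynomial ℤ) :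
    ∫ x, Hermite n x * Polynomial.aeval x P ∂gaussianReal 0 1
      = ∫ x, Polynomial.aeval x (Polynomial.derivative^[n] P) ∂gaussianReal 0 1 := by
  induction n generalizing P with
  | zero => simp [Hermite]
  | succ n ih =>
    have hi (m : ℕ) (Q : Polynomial ℤ) := integrable_aeval (Polynomial.hermite m * Q)
    simp only [map_mul] at hi
    rw [integral_Hermite_succ_mul n (fun x => P.hasDerivAt_aeval x) (hi n P) (hi (n + 1) P)
      (hi n _), ih, Function.iterate_succ_apply]

theorem integral_Hermite_mul_Hermite_of_lt {m n : ℕ} (h : m < n) :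
    ∫ x, Hermite n x * Hermite m x ∂gaussianReal 0 1 = 0 := by
  have := integral_Hermite_mul_aeval n (Polynomial.hermite m)
  rw [Polynomial.iterate_derivative_eq_zero (by simpa using h)] at this
  simpa [Hermite] using this

theorem integral_Hermite_mul_self (n : ℕ) :
    ∫ x, Hermite n x * Hermite n x ∂gaussianReal 0 1 = n.factorial := by
  have := integral_Hermite_mul_aeval n (Polynomial.hermite n)
  have h : Polynomial.derivative^[n] (Polynomial.hermite n) = Polynomial.C (n.factorial : ℤ) := by
    have h := Polynomial.natDegree_iterate_derivative (Polynomial.hermite n) n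
    rw [Polynomial.natDegree_hermite, Nat.sub_self, Nat.le_zero] at h
    rw [Polynomial.eq_C_of_natDegree_eq_zero h, Polynomial.coeff_iterate_derivative]
    simp [Nat.descFactorial_self]
  rw [h] at this
  simpa [Hermite] using this

theorem integral_Hermite_mul_Hermite (m n : ℕ) :
    ∫ x, Hermite m x * Hermite n x ∂gaussianReal 0 1 = if m = n then (n.factorial : ℝ) else 0 := by
  rcases lt_trichotomy m n with h | rfl | h
  · simp_rw [mul_comm (Hermite m _)]
    rw [integral_Hermite_mul_Hermite_of_lt h, if_neg h.ne]
  · rw [integral_Hermite_mul_self, if_pos rfl]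
  · rw [integral_Hermite_mul_Hermite_of_lt h, if_neg h.ne']

theorem sq_integral_mul_le {α : Type*} {m : MeasurableSpace α} {μ : Measure α} {f g : α → ℝ}
    (hf : MemLp f 2 μ) (hg : MemLp g 2 μ) :
    (∫ x, f x * g x ∂μ) ^ 2 ≤ (∫ x, f x ^ 2 ∂μ) * ∫ x, g x ^ 2 ∂μ := by
  have hfg : Integrable (fun x => f x * g x) μ := hf.integrable_mul hg
  have hg₂ := hg.integrable_sq
  have h (c : ℝ) : 0 ≤ (∫ x, g x ^ 2 ∂μ) * (c * c) + (2 * ∫ x, f x * g x ∂μ) * c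
      + ∫ x, f x ^ 2 ∂μ := by
    have h₀ : 0 ≤ ∫ x, (c * c) * g x ^ 2 + (2 * c) * (f x * g x) + f x ^ 2 ∂μ :=
      integral_nonneg fun x => by
        have := sq_nonneg (c * g x + f x)
        simp only [Pi.zero_apply]
        linarith
    rw [integral_add (by fun_prop) hf.integrable_sq, integral_add (by fun_prop) (by fun_prop),
      integral_const_mul, integral_const_mul] at h₀
    linarith
  have := discrim_le_zero h
  unfold discrim at this
  linarith

/-- The squared `L²` norm of the part of `exp (t x - t² / 2)` orthogonal to the Hermite polynomials
with index in `s`. -/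
theorem integral_sq_exp_sub_sum_Hermite (s : Finset ℕ) (t : ℝ) :
    ∫ x, (exp (-(t ^ 2 / 2)) * exp (t * x)
        - ∑ n ∈ s, t ^ n / n.factorial * Hermite n x) ^ 2 ∂gaussianReal 0 1
      = exp (t ^ 2) - ∑ n ∈ s, (t ^ 2) ^ n / n.factorial := by
  have hE := (memLp_exp_mul t).const_mul (exp (-(t ^ 2 / 2)))
  have hS : MemLp (fun x => ∑ n ∈ s, t ^ n / n.factorial * Hermite n x) 2 (gaussianReal 0 1) :=
    memLp_finsetSum _ fun n _ => (memLp_Hermite n).const_mul _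
  have hHE (n : ℕ) : Integrable (fun x => Hermite n x * exp (t * x)) (gaussianReal 0 1) :=
    (memLp_Hermite n).integrable_mul (memLp_exp_mul t)
  have hHH (m n : ℕ) : Integrable (fun x => Hermite m x * Hermite n x) (gaussianReal 0 1) :=
    (memLp_Hermite m).integrable_mul (memLp_Hermite n)
  have hexp : exp (-(t ^ 2 / 2)) * exp (t ^ 2 / 2) = 1 := by rw [← exp_add]; simp
  have h₁ : ∫ x, (exp (-(t ^ 2 / 2)) * exp (t * x)) ^ 2 ∂gaussianReal 0 1 = exp (t ^ 2) := by
    have := integral_Hermite_mul_exp 0 (2 * t)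
    simp only [Hermite, Polynomial.hermite_zero, map_one, one_mul, pow_zero] at this
    simp only [mul_pow, ← exp_nat_mul, integral_const_mul]
    push_cast
    simp only [← mul_assoc, this, ← exp_add]
    ring_nf
  have h₂ : ∫ x, (exp (-(t ^ 2 / 2)) * exp (t * x)) *
      (∑ n ∈ s, t ^ n / n.factorial * Hermite n x) ∂gaussianReal 0 1
      = ∑ n ∈ s, (t ^ 2) ^ n / n.factorial := by
    have (x : ℝ) : (exp (-(t ^ 2 / 2)) * exp (t * x)) *
        (∑ n ∈ s, t ^ n / n.factorial * Hermite n x)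
        = ∑ n ∈ s, (exp (-(t ^ 2 / 2)) * (t ^ n / n.factorial)) * (Hermite n x * exp (t * x)) := by
      rw [Finset.mul_sum]
      exact Finset.sum_congr rfl fun _ _ => by ring
    simp only [this]
    rw [integral_finsetSum _ fun n _ => (hHE n).const_mul _]
    refine Finset.sum_congr rfl fun n _ => ?_
    rw [integral_const_mul, integral_Hermite_mul_exp]
    linear_combination (t ^ n * t ^ n / n.factorial) * hexp
  have h₃ : ∫ x, (∑ n ∈ s, t ^ n / n.factorial * Hermite n x) ^ 2 ∂gaussianReal 0 1
      = ∑ n ∈ s, (t ^ 2) ^ n / n.factorial := by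
    have (x : ℝ) : (∑ n ∈ s, t ^ n / n.factorial * Hermite n x) ^ 2
        = ∑ m ∈ s, ∑ n ∈ s, (t ^ m / m.factorial * (t ^ n / n.factorial))
          * (Hermite m x * Hermite n x) := by
      rw [sq, Finset.sum_mul_sum]
      exact Finset.sum_congr rfl fun _ _ => Finset.sum_congr rfl fun _ _ => by ring
    simp only [this]
    rw [integral_finsetSum _ fun m _ => integrable_finsetSum _ fun n _ => (hHH m n).const_mul _]
    refine Finset.sum_congr rfl fun m hm => ?_
    rw [integral_finsetSum _ fun n _ => (hHH m n).const_mul _]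
    simp only [integral_const_mul, integral_Hermite_mul_Hermite, mul_ite, mul_zero,
      Finset.sum_ite_eq, if_pos hm]
    field_simp
    ring
  have hE₂ := hE.integrable_sq
  have hES : Integrable (fun x => 2 * (exp (-(t ^ 2 / 2)) * exp (t * x) *
      ∑ n ∈ s, t ^ n / n.factorial * Hermite n x)) (gaussianReal 0 1) :=
    (hE.integrable_mul hS).const_mul 2
  have hsq (a b : ℝ) : (a - b) ^ 2 = a ^ 2 - 2 * (a * b) + b ^ 2 := by ring
  simp only [hsq]
  rw [integral_add (by fun_prop) hS.integrable_sq, integral_sub hE₂ hES, integral_const_mul,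
    h₁, h₂, h₃]
  ring

/-- Bound on the exponential moments of a measure with `L²` Gaussian density `1 + d` that is
orthogonal to the Hermite polynomials with index in `s`. -/
theorem sq_integral_exp_mul_le {d : ℝ → ℝ} (hd : MemLp d 2 (gaussianReal 0 1)) (s : Finset ℕ)
    (hs : ∀ n ∈ s, ∫ x, Hermite n x * d x ∂gaussianReal 0 1 = 0) (t : ℝ) :
    (exp (-(t ^ 2 / 2)) * ∫ x, exp (t * x) * d x ∂gaussianReal 0 1) ^ 2
      ≤ (exp (t ^ 2) - ∑ n ∈ s, (t ^ 2) ^ n / n.factorial)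
        * ∫ x, d x ^ 2 ∂gaussianReal 0 1 := by
  have hE := (memLp_exp_mul t).const_mul (exp (-(t ^ 2 / 2)))
  have hS : MemLp (fun x => ∑ n ∈ s, t ^ n / n.factorial * Hermite n x) 2 (gaussianReal 0 1) :=
    memLp_finsetSum _ fun n _ => (memLp_Hermite n).const_mul _
  have hHd (n : ℕ) : Integrable (fun x => Hermite n x * d x) (gaussianReal 0 1) :=
    (memLp_Hermite n).integrable_mul hd
  have hSd : ∫ x, (∑ n ∈ s, t ^ n / n.factorial * Hermite n x) * d x ∂gaussianReal 0 1 = 0 := by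
    simp only [Finset.sum_mul, mul_assoc]
    rw [integral_finsetSum _ fun n _ => (hHd n).const_mul _]
    exact Finset.sum_eq_zero fun n hn => by rw [integral_const_mul, hs n hn, mul_zero]
  rw [← integral_sq_exp_sub_sum_Hermite]
  convert sq_integral_mul_le (hE.sub hS) hd using 2
  · have h := integral_sub (hE.integrable_mul hd) (hS.integrable_mul hd)
    simp only [Pi.mul_apply, hSd, sub_zero] at h
    simp only [Pi.sub_apply, sub_mul, h]
    simp only [mul_assoc, integral_const_mul]
  · rfl

theorem integral_comp_eq_integral_gaussianReal {Ω : Type*} [MeasureSpace Ω]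
    [IsProbabilityMeasure (ℙ : Measure Ω)] {Y : Ω → ℝ} (hpdf : HasPDF Y ℙ) {f : ℝ → ℝ}
    (hf : Measurable f) :
    ∫ ω, f (Y ω) = ∫ x, f x * (1 + ((pdf Y ℙ volume x).toReal / stdGaussianDensity x - 1))
      ∂gaussianReal 0 1 := by
  rw [← pdf.integral_pdf_smul (μ := volume) hf.aestronglyMeasurable, integral_gaussianReal_eq]
  congr with x
  have := (stdGaussianDensity_pos x).ne'
  simp only [smul_eq_mul]
  field_simp
  ring

theorem integrable_comp_iff_gaussianReal {Ω : Type*} [MeasureSpace Ω]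
    [IsProbabilityMeasure (ℙ : Measure Ω)] {Y : Ω → ℝ} (hpdf : HasPDF Y ℙ) {f : ℝ → ℝ}
    (hf : Measurable f) :
    Integrable (fun ω => f (Y ω)) ↔
      Integrable (fun x => f x * (1 + ((pdf Y ℙ volume x).toReal / stdGaussianDensity x - 1)))
        (gaussianReal 0 1) := by
  rw [← pdf.integrable_pdf_smul_iff (μ := volume) hf.aestronglyMeasurable,
    integrable_gaussianReal_iff]
  congr! 2 with x
  have := (stdGaussianDensity_pos x).ne'
  simp only [smul_eq_mul]
  field_simp
  ring

theorem stmt14 {Ω : Type} [MeasureSpace Ω] [IsProbabilityMeasure (ℙ : Measure Ω)]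
    (Y : Ω → ℝ) (hpdf : HasPDF Y ℙ) (hfin : HasFiniteChiSq Y)
    (J : Set ℕ) (hJpos : ∀ k ∈ J, 1 ≤ k)
    (hJ : ∀ k ∈ J, ∫ ω, Hermite k (Y ω) = 0)
    (hchi : chiSqDist Y <
      ⨅ x : {x : ℝ // 0 < x},
        (Real.exp ((x:ℝ)/2) - 1)^2
          / (Real.exp (x:ℝ) - 1 - ∑' k : ℕ, if k ∈ J then (x:ℝ)^k / (Nat.factorial k) else 0)) :
    ∀ t : ℝ, t ≠ 0 →
      ∫⁻ ω, ENNReal.ofReal (Real.exp (t * Y ω)) < ENNReal.ofReal (Real.exp (t^2)) := by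
  intro t ht
  set d : ℝ → ℝ := fun x => (pdf Y ℙ volume x).toReal / stdGaussianDensity x - 1 with hd_def
  have hdm : Measurable d :=
    ((measurable_pdf Y ℙ volume).ennreal_toReal.div measurable_stdGaussianDensity).sub_const 1
  have hd : MemLp d 2 (gaussianReal 0 1) := by
    rw [memLp_two_iff_integrable_sq hdm.aestronglyMeasurable, integrable_gaussianReal_iff]
    exact hfin
  have hchi_eq : chiSqDist Y = ∫ x, d x ^ 2 ∂gaussianReal 0 1 := by
    rw [integral_gaussianReal_eq]
    rfl
  have hH_meas (n : ℕ) : Measurable (Hermite n) := (Polynomial.continuous_aeval _).measurable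
  have hsplit {f : ℝ → ℝ} (hfm : Measurable f) (hf : MemLp f 2 (gaussianReal 0 1)) :
      ∫ ω, f (Y ω) = ∫ x, f x ∂gaussianReal 0 1 + ∫ x, f x * d x ∂gaussianReal 0 1 := by
    rw [integral_comp_eq_integral_gaussianReal hpdf hfm]
    simp only [mul_add, mul_one]
    exact integral_add (hf.integrable one_le_two) (hf.integrable_mul hd)
  have hHd : ∀ n ∈ insert 0 J, ∫ x, Hermite n x * d x ∂gaussianReal 0 1 = 0 := by
    intro n hn
    have h := hsplit (hH_meas n) (memLp_Hermite n)
    have h0 := integral_Hermite_mul_Hermite n 0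
    simp only [Hermite, Polynomial.hermite_zero, map_one, mul_one] at h0
    rcases hn with rfl | hn
    · simpa [Hermite] using h
    · rw [hJ n hn] at h
      simp only [Hermite] at h ⊢
      rw [h0, if_neg (Nat.one_le_iff_ne_zero.1 (hJpos n hn))] at h
      linarith
  set a : ℕ → ℝ → ℝ := fun k x => if k ∈ J then x ^ k / k.factorial else 0 with ha
  have hsum (x : ℝ) : Summable fun k => a k x := by
    have := (Real.summable_pow_div_factorial x).indicator J
    exact this.congr fun k => by simp [Set.indicator_apply, ha]
  have hfinset (N : ℕ) (x : ℝ) :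
      ∑ n ∈ insert 0 ((Finset.range N).filter (· ∈ J)), x ^ n / n.factorial
        = 1 + ∑ k ∈ Finset.range N, a k x := by
    rw [Finset.sum_insert, Finset.sum_filter]
    · simp [ha]
    · intro h
      exact absurd (hJpos 0 (Finset.mem_filter.1 h).2) (by norm_num)
  have hlim (x : ℝ) : Filter.Tendsto (fun N => exp x - (1 + ∑ k ∈ Finset.range N, a k x))
      Filter.atTop (nhds (exp x - 1 - ∑' k, a k x)) := by
    rw [sub_sub]
    exact ((hsum x).hasSum.tendsto_sum_nat.const_add 1).const_sub _
  have hD (x : ℝ) (hx : 0 < x) : 0 ≤ exp x - 1 - ∑' k, a k x := by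
    refine ge_of_tendsto' (hlim x) fun N => ?_
    rw [← hfinset, ← Real.sq_sqrt hx.le, ← integral_sq_exp_sub_sum_Hermite]
    exact integral_nonneg fun _ => sq_nonneg _
  have hx : 0 < t ^ 2 := by positivity
  have hlt : chiSqDist Y < (exp (t ^ 2 / 2) - 1) ^ 2 / (exp (t ^ 2) - 1 - ∑' k, a k (t ^ 2)) := by
    refine hchi.trans_le (ciInf_le ⟨0, ?_⟩ (⟨t ^ 2, hx⟩ : {x : ℝ // 0 < x}))
    rintro _ ⟨⟨x, hx⟩, rfl⟩
    exact div_nonneg (sq_nonneg _) (hD x hx)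
  have hchi_nonneg : 0 ≤ chiSqDist Y := hchi_eq ▸ integral_nonneg fun _ => sq_nonneg _
  have hDpos : 0 < exp (t ^ 2) - 1 - ∑' k, a k (t ^ 2) := by
    refine (hD _ hx).lt_of_ne fun h => ?_
    rw [← h, div_zero] at hlt
    exact hlt.not_ge hchi_nonneg
  have hbound : (exp (-(t ^ 2 / 2)) * ∫ x, exp (t * x) * d x ∂gaussianReal 0 1) ^ 2
      ≤ (exp (t ^ 2) - 1 - ∑' k, a k (t ^ 2)) * chiSqDist Y := by
    refine ge_of_tendsto' ((hlim (t ^ 2)).mul_const _) fun N => ?_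
    rw [← hfinset, hchi_eq]
    refine sq_integral_exp_mul_le hd _ (fun n hn => hHd n ?_) t
    rcases Finset.mem_insert.1 hn with rfl | hn
    · exact Set.mem_insert _ _
    · exact Set.mem_insert_of_mem _ (Finset.mem_filter.1 hn).2
  have hstrict : exp (-(t ^ 2 / 2)) * ∫ x, exp (t * x) * d x ∂gaussianReal 0 1
      < exp (t ^ 2 / 2) - 1 := by
    refine lt_of_pow_lt_pow_left₀ 2 ?_ (hbound.trans_lt ?_)
    · linarith [Real.one_le_exp (by positivity : 0 ≤ t ^ 2 / 2)]
    · rwa [mul_comm, ← lt_div_iff₀ hDpos]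
  have hem : Measurable fun x : ℝ => exp (t * x) := by fun_prop
  have hint : Integrable fun ω => exp (t * Y ω) := by
    rw [integrable_comp_iff_gaussianReal hpdf hem]
    simp only [mul_add, mul_one]
    exact ((memLp_exp_mul t).integrable one_le_two).add ((memLp_exp_mul t).integrable_mul hd)
  rw [← ofReal_integral_eq_lintegral_ofReal hint (.of_forall fun _ => (exp_pos _).le),
    ENNReal.ofReal_lt_ofReal_iff (exp_pos _), hsplit hem (memLp_exp_mul t)]
  have h0 := integral_Hermite_mul_exp 0 t
  simp only [Hermite, Polynomial.hermite_zero, map_one, one_mul, pow_zero] at h0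
  rw [h0]
  have hmul := mul_lt_mul_of_pos_left hstrict (exp_pos (t ^ 2 / 2))
  rw [← mul_assoc, ← exp_add, add_neg_cancel, exp_zero, one_mul, mul_sub, ← exp_add,
    add_halves, mul_one] at hmul
  linarith
end
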